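/- Let G be a group whose abelianization is finitely generated, and let q : G → G/D²G be the quotient by the second derived subgroup. A character χ : G → ℂˣ lies in Σ¹(G) if and only if the induced character χ̄ of G/D²G (which exists since χ is trivial on DG ⊇ D²G) lies in Σ¹(G/D²G). In other words, Σ¹(G) depends only on the metabelianization G/D²G. (Claim stated in §3.2.) -/

import Mathlib

/-- A `1`-cocycle of a group `G` with values in the one-dimensional representation `ℂ_χ`
attached to a character `χ : G → ℂˣ`. -/
def IsCocycle {G : Type*} [Group G] (χ : G →* ℂˣ) (c : G → ℂ) : Prop :=
  ∀ g h : G, c (g * h) = c g + (χ g : ℂ) * c h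

/-- A `1`-coboundary of a group `G` with values in `ℂ_χ`. -/
def IsCoboundary {G : Type*} [Group G] (χ : G →* ℂˣ) (c : G → ℂ) : Prop :=
  ∃ z : ℂ, ∀ g : G, c g = (χ g : ℂ) * z - z

/-- The Green–Lazarsfeld set `Σ¹(G)`. -/
def greenLazarsfeld (G : Type*) [Group G] : Set (G →* ℂˣ) :=
  {χ | ∃ c : G → ℂ, IsCocycle χ c ∧ ¬ IsCoboundary χ c}

open scoped commutatorElement in
theorem IsCocycle.map_commutatorElement {G : Type*} [Group G] {χ : G →* ℂˣ} {c : G → ℂ}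
    (hc : IsCocycle χ c) {a b : G} (ha : χ a = 1) (hb : χ b = 1) : c ⁅a, b⁆ = 0 := by
  have hχ : χ ⁅a, b⁆ = 1 := by simp [commutatorElement_def, ha, hb]
  have h := hc ⁅a, b⁆ (b * a)
  rw [show ⁅a, b⁆ * (b * a) = a * b by simp [commutatorElement_def, mul_assoc],
    hc a b, hc b a, ha, hb, hχ] at h
  simp only [Units.val_one, one_mul] at h
  linear_combination -h

/-- A cocycle with values in `ℂ_χ` restricts to a homomorphism on `ker χ`; this is the kernel of
that restriction. -/
def IsCocycle.kernel {G : Type*} [Group G] {χ : G →* ℂˣ} {c : G → ℂ}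
    (hc : IsCocycle χ c) : Subgroup G where
  carrier := {g | χ g = 1 ∧ c g = 0}
  one_mem' := ⟨map_one χ, by simpa using hc 1 1⟩
  mul_mem' := by
    rintro a b ⟨ha, ha'⟩ ⟨hb, hb'⟩
    exact ⟨by rw [map_mul, ha, hb, one_mul], by rw [hc, ha', hb', mul_zero, add_zero]⟩
  inv_mem' := by
    rintro a ⟨ha, ha'⟩
    have h1 : c 1 = 0 := by simpa using hc 1 1
    have h := hc a a⁻¹
    rw [mul_inv_cancel, h1, ha', ha, Units.val_one, one_mul, zero_add] at h
    exact ⟨by rw [map_inv, ha, inv_one], h.symm⟩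

theorem derivedSeries_one_le_ker {G A : Type*} [Group G] [CommGroup A] (χ : G →* A) :
    derivedSeries G 1 ≤ χ.ker := by
  rw [derivedSeries_one]
  exact Abelianization.commutator_subset_ker χ

theorem IsCocycle.derivedSeries_two_le_kernel {G : Type*} [Group G] {χ : G →* ℂˣ} {c : G → ℂ}
    (hc : IsCocycle χ c) : derivedSeries G 2 ≤ hc.kernel := by
  rw [derivedSeries_succ, Subgroup.commutator_le]
  intro a ha b hb
  have ha := MonoidHom.mem_ker.1 (derivedSeries_one_le_ker χ ha)
  have hb := MonoidHom.mem_ker.1 (derivedSeries_one_le_ker χ hb)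
  exact ⟨by simp [commutatorElement_def, ha, hb], hc.map_commutatorElement ha hb⟩

theorem isCocycle_comp_iff {G H : Type*} [Group G] [Group H] {f : G →* H}
    (hf : Function.Surjective f) {χ : H →* ℂˣ} {c : H → ℂ} :
    IsCocycle (χ.comp f) (c ∘ f) ↔ IsCocycle χ c := by
  simp [IsCocycle, hf.forall]

theorem isCoboundary_comp_iff {G H : Type*} [Group G] [Group H] {f : G →* H}
    (hf : Function.Surjective f) {χ : H →* ℂˣ} {c : H → ℂ} :
    IsCoboundary (χ.comp f) (c ∘ f) ↔ IsCoboundary χ c := by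
  simp [IsCoboundary, hf.forall]

theorem IsCocycle.eq_of_inv_mul_mem_kernel {G : Type*} [Group G] {χ : G →* ℂˣ} {c : G → ℂ}
    (hc : IsCocycle χ c) {a b : G} (h : a⁻¹ * b ∈ hc.kernel) : c a = c b := by
  have hab := hc a (a⁻¹ * b)
  rw [mul_inv_cancel_left, h.2, mul_zero, add_zero] at hab
  exact hab.symm

/-- Let `G` have finitely generated abelianization, and let `q : G → G/D²G` be the quotient by
the second derived subgroup.  A character `χ` of `G` lies in `Σ¹(G)` if and only if the induced
character `χ̄` of `G/D²G` (with `χ = χ̄ ∘ q`) lies in `Σ¹(G/D²G)`: the Green–Lazarsfeld set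
depends only on the metabelianization. -/
theorem greenLazarsfeld_depends_only_on_metabelianization
    {G : Type*} [Group G] (hfg : Group.FG (Abelianization G)) (χ : G →* ℂˣ) :
    letI := derivedSeries_normal G 2
    ∀ χbar : (G ⧸ derivedSeries G 2) →* ℂˣ,
      χ = χbar.comp (QuotientGroup.mk' (derivedSeries G 2)) →
      (χ ∈ greenLazarsfeld G ↔ χbar ∈ greenLazarsfeld (G ⧸ derivedSeries G 2)) := by
  let := derivedSeries_normal G 2
  rintro χbar rfl
  have hq := QuotientGroup.mk'_surjective (derivedSeries G 2)
  constructor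
  · rintro ⟨c, hc, hnc⟩
    let d : G ⧸ derivedSeries G 2 → ℂ := Quotient.lift c fun a b hab =>
      hc.eq_of_inv_mul_mem_kernel
        (hc.derivedSeries_two_le_kernel (QuotientGroup.leftRel_apply.1 hab))
    have hd : d ∘ QuotientGroup.mk' (derivedSeries G 2) = c := rfl
    rw [← hd] at hc hnc
    exact ⟨d, (isCocycle_comp_iff hq).1 hc, fun h => hnc ((isCoboundary_comp_iff hq).2 h)⟩
  · rintro ⟨d, hd, hnd⟩
    exact ⟨d ∘ QuotientGroup.mk' (derivedSeries G 2), (isCocycle_comp_iff hq).2 hd,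
      fun h => hnd ((isCoboundary_comp_iff hq).1 h)⟩
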